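/- In the definition of the entanglement of formation, the infimum over pure-state decompositions equals the infimum over decompositions into arbitrary density matrices. Precisely: let A, B be finite types and ρ a density matrix on A × B. Then the infimum, over all finite families (p_i, ψ_i)_{i ∈ Fin N} with p_i > 0, ∑_i p_i = 1, ψ_i unit vectors in ℂ^{A×B}, and ∑_i p_i |ψ_i⟩⟨ψ_i| = ρ, of ∑_i p_i S(tr_A(|ψ_i⟩⟨ψ_i|)), equals the infimum, over all finite families (p_i, σ_i)_{i ∈ Fin N} with p_i > 0, ∑_i p_i = 1, σ_i density matrices on A × B, and ∑_i p_i σ_i = ρ, of ∑_i p_i S(tr_A(σ_i)). -/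

import Mathlib

open Matrix
open scoped ComplexOrder

/-- A density matrix: positive semidefinite with trace one. -/
def IsDensityMatrix {I : Type*} [Fintype I] [DecidableEq I] (ρ : Matrix I I ℂ) : Prop :=
  ρ.PosSemidef ∧ ρ.trace = 1

/-- The partial trace over the first tensor factor. -/
noncomputable def ptraceA {A B : Type*} [Fintype A] (σ : Matrix (A × B) (A × B) ℂ) : Matrix B B ℂ :=
  Matrix.of fun b b' => ∑ a, σ (a, b) (a, b')

/-- The von Neumann entropy `S(σ) = ∑ᵢ -λᵢ log λᵢ` of a (Hermitian) matrix. -/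
noncomputable def vonNeumannEntropy {I : Type*} [Fintype I] [DecidableEq I]
    (σ : Matrix I I ℂ) : ℝ :=
  if h : σ.IsHermitian then ∑ i, Real.negMulLog (h.eigenvalues i) else 0

/-- The rank-one projector `|ψ⟩⟨ψ|`. -/
def outer {I : Type*} (ψ : I → ℂ) : Matrix I I ℂ :=
  Matrix.of fun i j => ψ i * (starRingEnd ℂ) (ψ j)

/-- Values of `∑ pᵢ S(tr_A |ψᵢ⟩⟨ψᵢ|)` over pure-state decompositions of `ρ`. -/
noncomputable def pureDecompVals {A B : Type*} [Fintype A] [Fintype B]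
    [DecidableEq A] [DecidableEq B] (ρ : Matrix (A × B) (A × B) ℂ) : Set ℝ :=
  {x | ∃ (N : ℕ) (p : Fin N → ℝ) (ψ : Fin N → (A × B → ℂ)),
    (∀ i, 0 < p i) ∧ (∑ i, p i = 1) ∧
    (∀ i, ∑ z, Complex.normSq (ψ i z) = 1) ∧
    (∑ i, (p i : ℂ) • outer (ψ i)) = ρ ∧
    x = ∑ i, p i * vonNeumannEntropy (ptraceA (outer (ψ i)))}

/-- Values of `∑ pᵢ S(tr_A σᵢ)` over decompositions of `ρ` into density matrices. -/
noncomputable def mixedDecompVals {A B : Type*} [Fintype A] [Fintype B]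
    [DecidableEq A] [DecidableEq B] (ρ : Matrix (A × B) (A × B) ℂ) : Set ℝ :=
  {x | ∃ (N : ℕ) (p : Fin N → ℝ) (σ : Fin N → Matrix (A × B) (A × B) ℂ),
    (∀ i, 0 < p i) ∧ (∑ i, p i = 1) ∧
    (∀ i, IsDensityMatrix (σ i)) ∧
    (∑ i, (p i : ℂ) • σ i) = ρ ∧
    x = ∑ i, p i * vonNeumannEntropy (ptraceA (σ i))}

theorem outer_posSemidef {I : Type*} [Fintype I] (ψ : I → ℂ) : (outer ψ).PosSemidef :=
  Matrix.posSemidef_vecMulVec_self_star ψ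

theorem isDensityMatrix_outer {I : Type*} [Fintype I] [DecidableEq I] {ψ : I → ℂ}
    (hψ : ∑ z, Complex.normSq (ψ z) = 1) : IsDensityMatrix (outer ψ) := by
  refine ⟨outer_posSemidef ψ, ?_⟩
  simp only [Matrix.trace, Matrix.diag, outer, Matrix.of_apply, Complex.mul_conj]
  exact_mod_cast hψ

theorem ptraceA_eq_sum_submatrix {A B : Type*} [Fintype A] (σ : Matrix (A × B) (A × B) ℂ) :
    ptraceA σ = ∑ a, σ.submatrix (fun b => (a, b)) (fun b => (a, b)) := by
  ext b b'
  simp [ptraceA, Matrix.sum_apply]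

theorem ptraceA_posSemidef {A B : Type*} [Fintype A] {σ : Matrix (A × B) (A × B) ℂ}
    (hσ : σ.PosSemidef) : (ptraceA σ).PosSemidef := by
  rw [ptraceA_eq_sum_submatrix]
  exact Matrix.posSemidef_sum _ fun a _ => hσ.submatrix _

theorem ptraceA_sum_smul {A B ι : Type*} [Fintype A] [Fintype ι] (c : ι → ℂ)
    (σ : ι → Matrix (A × B) (A × B) ℂ) :
    ptraceA (∑ i, c i • σ i) = ∑ i, c i • ptraceA (σ i) := by
  ext b b'
  simp only [ptraceA, Matrix.of_apply, Matrix.sum_apply, Matrix.smul_apply, smul_eq_mul,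
    Finset.mul_sum]
  exact Finset.sum_comm

theorem trace_ptraceA {A B : Type*} [Fintype A] [Fintype B] (σ : Matrix (A × B) (A × B) ℂ) :
    (ptraceA σ).trace = σ.trace := by
  simp only [Matrix.trace, Matrix.diag, ptraceA, Matrix.of_apply, Fintype.sum_prod_type]
  exact Finset.sum_comm

theorem IsDensityMatrix.ptraceA {A B : Type*} [Fintype A] [Fintype B] [DecidableEq A]
    [DecidableEq B] {σ : Matrix (A × B) (A × B) ℂ} (hσ : IsDensityMatrix σ) :
    IsDensityMatrix (ptraceA σ) :=
  ⟨ptraceA_posSemidef hσ.1, (trace_ptraceA σ).trans hσ.2⟩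

theorem IsDensityMatrix.sum_eigenvalues {I : Type*} [Fintype I] [DecidableEq I]
    {σ : Matrix I I ℂ} (hσ : IsDensityMatrix σ) : ∑ i, hσ.1.1.eigenvalues i = 1 := by
  have h : ∑ i, (hσ.1.1.eigenvalues i : ℂ) = 1 :=
    hσ.1.1.trace_eq_sum_eigenvalues.symm.trans hσ.2
  exact_mod_cast h

theorem IsDensityMatrix.vonNeumannEntropy_nonneg {I : Type*} [Fintype I] [DecidableEq I]
    {σ : Matrix I I ℂ} (hσ : IsDensityMatrix σ) : 0 ≤ vonNeumannEntropy σ := by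
  rw [vonNeumannEntropy, dif_pos hσ.1.1]
  refine Finset.sum_nonneg fun i _ => Real.negMulLog_nonneg (hσ.1.eigenvalues_nonneg i) ?_
  rw [← hσ.sum_eigenvalues]
  exact Finset.single_le_sum (fun j _ => hσ.1.eigenvalues_nonneg j) (Finset.mem_univ i)

theorem sum_normSq_row {I : Type*} [Fintype I] [DecidableEq I] (V : Matrix.unitaryGroup I ℂ)
    (k : I) : ∑ l, Complex.normSq (V k l) = 1 := by
  have h := congrFun (congrFun (Matrix.mem_unitaryGroup_iff.mp V.2) k) k
  simp only [Matrix.mul_apply, Matrix.star_apply, RCLike.star_def, Complex.mul_conj,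
    Matrix.one_apply_eq] at h
  exact_mod_cast h

theorem sum_normSq_col {I : Type*} [Fintype I] [DecidableEq I] (V : Matrix.unitaryGroup I ℂ)
    (l : I) : ∑ k, Complex.normSq (V k l) = 1 := by
  have h := congrFun (congrFun (Matrix.mem_unitaryGroup_iff'.mp V.2) l) l
  simp only [Matrix.mul_apply, Matrix.star_apply, RCLike.star_def, mul_comm _ (V.1 _ _),
    Complex.mul_conj, Matrix.one_apply_eq] at h
  exact_mod_cast h

theorem mul_diagonal_mul_star_apply_self {I : Type*} [Fintype I] [DecidableEq I]
    (V : Matrix I I ℂ) (d : I → ℝ) (k : I) :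
    ((V * Matrix.diagonal (fun l => (d l : ℂ)) * star V) k k).re =
      ∑ l, Complex.normSq (V k l) * d l := by
  rw [Matrix.mul_apply, Complex.re_sum]
  refine Finset.sum_congr rfl fun l _ => ?_
  rw [Matrix.mul_diagonal, Matrix.star_apply, RCLike.star_def, mul_right_comm, Complex.mul_conj, ← Complex.ofReal_mul, Complex.ofReal_re]

theorem Matrix.IsHermitian.eq_mul_diagonal_mul_star {I : Type*} [Fintype I] [DecidableEq I]
    {M : Matrix I I ℂ} (hM : M.IsHermitian) :
    M = (hM.eigenvectorUnitary : Matrix I I ℂ) *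
      Matrix.diagonal (fun l => (hM.eigenvalues l : ℂ)) *
        star (hM.eigenvectorUnitary : Matrix I I ℂ) :=
  hM.spectral_theorem

/-- Measuring in an arbitrary orthonormal basis does not decrease the entropy. -/
theorem vonNeumannEntropy_le_sum_negMulLog_diag {I : Type*} [Fintype I] [DecidableEq I]
    {M : Matrix I I ℂ} (hM : M.PosSemidef) (U : Matrix.unitaryGroup I ℂ) :
    vonNeumannEntropy M ≤
      ∑ k, Real.negMulLog ((star (U : Matrix I I ℂ) * M * (U : Matrix I I ℂ)) k k).re := by
  set V : Matrix.unitaryGroup I ℂ := star U * hM.1.eigenvectorUnitary with hV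
  have hconj : star (U : Matrix I I ℂ) * M * (U : Matrix I I ℂ) =
      (V : Matrix I I ℂ) * Matrix.diagonal (fun l => (hM.1.eigenvalues l : ℂ)) *
        star (V : Matrix I I ℂ) := by
    conv_lhs => rw [hM.1.eq_mul_diagonal_mul_star]
    simp only [hV, Submonoid.coe_mul, Unitary.coe_star, star_mul, star_star, mul_assoc]
  rw [hconj, vonNeumannEntropy, dif_pos hM.1]
  simp only [mul_diagonal_mul_star_apply_self]
  calc ∑ l, Real.negMulLog (hM.1.eigenvalues l)
      = ∑ l, ∑ k, Complex.normSq (V k l) * Real.negMulLog (hM.1.eigenvalues l) := by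
        simp only [← Finset.sum_mul, sum_normSq_col, one_mul]
    _ = ∑ k, ∑ l, Complex.normSq (V k l) * Real.negMulLog (hM.1.eigenvalues l) :=
        Finset.sum_comm
    _ ≤ _ := Finset.sum_le_sum fun k _ =>
        Real.concaveOn_negMulLog.le_map_sum (fun l _ => Complex.normSq_nonneg _)
          (sum_normSq_row V k) fun l _ => hM.eigenvalues_nonneg l

/-- Concavity of the von Neumann entropy. -/
theorem sum_mul_vonNeumannEntropy_le {I ι : Type*} [Fintype I] [DecidableEq I] [Fintype ι]
    {p : ι → ℝ} (hp : ∀ i, 0 ≤ p i) (hp1 : ∑ i, p i = 1) {M : ι → Matrix I I ℂ}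
    (hM : ∀ i, (M i).PosSemidef) :
    ∑ i, p i * vonNeumannEntropy (M i) ≤ vonNeumannEntropy (∑ i, (p i : ℂ) • M i) := by
  have hS : (∑ i, (p i : ℂ) • M i).PosSemidef :=
    Matrix.posSemidef_sum _ fun i _ => (hM i).smul (by exact_mod_cast hp i)
  set U := hS.1.eigenvectorUnitary with hU
  have hdiag : ∀ k, hS.1.eigenvalues k =
      ∑ i, p i * ((star (U : Matrix I I ℂ) * M i * (U : Matrix I I ℂ)) k k).re := by
    intro k
    have h : star (U : Matrix I I ℂ) * (∑ i, (p i : ℂ) • M i) * (U : Matrix I I ℂ) =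
        Matrix.diagonal (fun l => (hS.1.eigenvalues l : ℂ)) := by
      have h := hS.1.conjStarAlgAut_star_eigenvectorUnitary
      rwa [Unitary.conjStarAlgAut_star_apply] at h
    have h2 := congrArg Complex.re (congrFun (congrFun h k) k)
    rw [Matrix.diagonal_apply_eq, Complex.ofReal_re] at h2
    rw [← h2, Finset.mul_sum, Finset.sum_mul, Matrix.sum_apply, Complex.re_sum]
    simp
  rw [vonNeumannEntropy, dif_pos hS.1]
  calc ∑ i, p i * vonNeumannEntropy (M i)
      ≤ ∑ i, p i * ∑ k, Real.negMulLog
          ((star (U : Matrix I I ℂ) * M i * (U : Matrix I I ℂ)) k k).re :=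
        Finset.sum_le_sum fun i _ => mul_le_mul_of_nonneg_left
          (vonNeumannEntropy_le_sum_negMulLog_diag (hM i) U) (hp i)
    _ = ∑ k, ∑ i, p i * Real.negMulLog
          ((star (U : Matrix I I ℂ) * M i * (U : Matrix I I ℂ)) k k).re := by
        simp only [Finset.mul_sum]
        exact Finset.sum_comm
    _ ≤ _ := by
        refine Finset.sum_le_sum fun k _ => ?_
        rw [hdiag k]
        refine Real.concaveOn_negMulLog.le_map_sum (fun i _ => hp i) hp1 fun i _ => ?_
        exact (Complex.le_def.mp ((hM i).conjTranspose_mul_mul_same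
          (U : Matrix I I ℂ)).diag_nonneg).1

theorem IsDensityMatrix.exists_pure_decomposition {I : Type*} [Fintype I] [DecidableEq I]
    {σ : Matrix I I ℂ} (hσ : IsDensityMatrix σ) :
    ∃ (q : I → ℝ) (v : I → I → ℂ), (∀ i, 0 ≤ q i) ∧ ∑ i, q i = 1 ∧
      (∀ i, ∑ z, Complex.normSq (v i z) = 1) ∧ ∑ i, (q i : ℂ) • outer (v i) = σ := by
  refine ⟨hσ.1.1.eigenvalues, fun i z => hσ.1.1.eigenvectorUnitary z i,
    hσ.1.eigenvalues_nonneg, hσ.sum_eigenvalues, sum_normSq_col _, ?_⟩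
  conv_rhs => rw [hσ.1.1.eq_mul_diagonal_mul_star]
  ext a b
  rw [Matrix.sum_apply, Matrix.mul_apply]
  refine Finset.sum_congr rfl fun l _ => ?_
  rw [Matrix.mul_diagonal, Matrix.smul_apply, smul_eq_mul, outer, Matrix.of_apply,
    Matrix.star_apply]
  exact (mul_left_comm _ _ _).trans (mul_assoc _ _ _).symm

theorem sum_comp_equiv_subtype {ι κ E : Type*} [Fintype ι] [Fintype κ] [AddCommMonoid E]
    {P : ι → Prop} (e : κ ≃ {i // P i}) (f : ι → E) (hf : ∀ i, ¬ P i → f i = 0) :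
    ∑ j, f (e j) = ∑ i, f i := by
  refine Finset.sum_of_injOn (fun j => (e j : ι)) (fun a _ b _ h => e.injective (Subtype.ext h))
    (fun _ _ => Finset.mem_coe.mpr (Finset.mem_univ _)) (fun i _ hi => hf i fun hP => hi ?_)
    fun _ _ => rfl
  exact ⟨e.symm ⟨i, hP⟩, by simp, by simp⟩

/-- Pure-state decompositions may be indexed by any finite type and have zero weights. -/
theorem sum_mem_pureDecompVals {A B ι : Type*} [Fintype A] [Fintype B]
    [DecidableEq A] [DecidableEq B] [Fintype ι] {ρ : Matrix (A × B) (A × B) ℂ}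
    {p : ι → ℝ} {ψ : ι → (A × B → ℂ)} (hp : ∀ i, 0 ≤ p i) (hp1 : ∑ i, p i = 1)
    (hψ : ∀ i, ∑ z, Complex.normSq (ψ i z) = 1) (hρ : ∑ i, (p i : ℂ) • outer (ψ i) = ρ) :
    ∑ i, p i * vonNeumannEntropy (ptraceA (outer (ψ i))) ∈ pureDecompVals ρ := by
  classical
  let e := (Fintype.equivFin {i // p i ≠ 0}).symm
  refine ⟨_, fun j => p (e j), fun j => ψ (e j), fun j => (hp _).lt_of_ne' (e j).2, ?_,
    fun j => hψ _, ?_, ?_⟩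
  · rw [sum_comp_equiv_subtype e p fun i hi => not_not.mp hi, hp1]
  · rw [sum_comp_equiv_subtype e (fun i => (p i : ℂ) • outer (ψ i))
      fun i hi => by simp [not_not.mp hi], hρ]
  · rw [sum_comp_equiv_subtype e (fun i => p i * vonNeumannEntropy (ptraceA (outer (ψ i))))
      fun i hi => by simp [not_not.mp hi]]

theorem exists_mem_pureDecompVals_le {A B : Type*} [Fintype A] [Fintype B]
    [DecidableEq A] [DecidableEq B] {ρ : Matrix (A × B) (A × B) ℂ} {x : ℝ}
    (hx : x ∈ mixedDecompVals ρ) : ∃ y ∈ pureDecompVals ρ, y ≤ x := by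
  obtain ⟨N, p, σ, hp, hp1, hσ, rfl, rfl⟩ := hx
  choose q v hq hq1 hv hqv using fun i => (hσ i).exists_pure_decomposition
  refine ⟨_, sum_mem_pureDecompVals (ι := Fin N × (A × B))
    (p := fun ij => p ij.1 * q ij.1 ij.2) (ψ := fun ij => v ij.1 ij.2)
    (fun ij => mul_nonneg (hp _).le (hq _ _)) ?_ (fun ij => hv _ _) ?_, ?_⟩
  · rw [Fintype.sum_prod_type]
    simp only [← Finset.mul_sum, hq1, mul_one, hp1]
  · rw [Fintype.sum_prod_type]
    simp only [Complex.ofReal_mul, mul_smul, ← Finset.smul_sum, hqv]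
  · rw [Fintype.sum_prod_type]
    refine Finset.sum_le_sum fun i _ => ?_
    simp only [mul_assoc, ← Finset.mul_sum]
    refine mul_le_mul_of_nonneg_left ?_ (hp i).le
    rw [← hqv i, ptraceA_sum_smul]
    exact sum_mul_vonNeumannEntropy_le (hq i) (hq1 i) fun j =>
      ptraceA_posSemidef (outer_posSemidef _)

theorem pureDecompVals_subset_mixedDecompVals {A B : Type*} [Fintype A] [Fintype B]
    [DecidableEq A] [DecidableEq B] (ρ : Matrix (A × B) (A × B) ℂ) :
    pureDecompVals ρ ⊆ mixedDecompVals ρ := by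
  rintro x ⟨N, p, ψ, hp, hp1, hψ, hρ, hx⟩
  exact ⟨N, p, fun i => outer (ψ i), hp, hp1, fun i => isDensityMatrix_outer (hψ i), hρ, hx⟩

theorem bddBelow_mixedDecompVals {A B : Type*} [Fintype A] [Fintype B]
    [DecidableEq A] [DecidableEq B] (ρ : Matrix (A × B) (A × B) ℂ) :
    BddBelow (mixedDecompVals ρ) := by
  refine ⟨0, ?_⟩
  rintro x ⟨N, p, σ, hp, -, hσ, -, rfl⟩
  exact Finset.sum_nonneg fun i _ => mul_nonneg (hp i).le (hσ i).ptraceA.vonNeumannEntropy_nonneg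

theorem mixedDecompVals_nonempty {A B : Type*} [Fintype A] [Fintype B]
    [DecidableEq A] [DecidableEq B] {ρ : Matrix (A × B) (A × B) ℂ} (hρ : IsDensityMatrix ρ) :
    (mixedDecompVals ρ).Nonempty :=
  ⟨_, 1, fun _ => 1, fun _ => ρ, by simp, by simp, fun _ => hρ, by simp, rfl⟩

/-- In the definition of the entanglement of formation, the infimum over pure-state
decompositions equals the infimum over decompositions into arbitrary density matrices. -/
theorem eof_pure_eq_mixed_decompositions
    {A B : Type*} [Fintype A] [Fintype B] [DecidableEq A] [DecidableEq B]
    (ρ : Matrix (A × B) (A × B) ℂ) (hρ : IsDensityMatrix ρ) :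
    sInf (pureDecompVals ρ) = sInf (mixedDecompVals ρ) := by
  apply le_antisymm
  · refine le_csInf (mixedDecompVals_nonempty hρ) fun x hx => ?_
    obtain ⟨y, hy, hyx⟩ := exists_mem_pureDecompVals_le hx
    exact (csInf_le ((bddBelow_mixedDecompVals ρ).mono
      (pureDecompVals_subset_mixedDecompVals ρ)) hy).trans hyx
  · obtain ⟨x, hx⟩ := mixedDecompVals_nonempty hρ
    obtain ⟨y, hy, -⟩ := exists_mem_pureDecompVals_le hx
    exact csInf_le_csInf (bddBelow_mixedDecompVals ρ) ⟨y, hy⟩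
      (pureDecompVals_subset_mixedDecompVals ρ)
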